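/- arXiv:2501.14298 — 5 statements merged into one kernel-verified Lean document; each statement's English description precedes it below -/
import Mathlib

section
/- Let R be a (not necessarily commutative) ring and let a₁, a₂, b₁, b₂ ∈ R satisfy a₁² = a₂² = b₁² = b₂² = 1 and aᵢbⱼ = bⱼaᵢ for all i, j ∈ {1,2}. Let c = a₁b₁ + a₁b₂ + a₂b₁ − a₂b₂. Then c² = 4 − (a₁a₂ − a₂a₁)(b₁b₂ − b₂b₁). -/
theorem landau_identity {R : Type*} [Ring R] (a₁ a₂ b₁ b₂ : R)
    (ha₁ : a₁ ^ 2 = 1) (ha₂ : a₂ ^ 2 = 1) (hb₁ : b₁ ^ 2 = 1) (hb₂ : b₂ ^ 2 = 1)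
    (h11 : a₁ * b₁ = b₁ * a₁) (h12 : a₁ * b₂ = b₂ * a₁)
    (h21 : a₂ * b₁ = b₁ * a₂) (h22 : a₂ * b₂ = b₂ * a₂)
    (c : R) (hc : c = a₁ * b₁ + a₁ * b₂ + a₂ * b₁ - a₂ * b₂) :
    c ^ 2 = 4 - (a₁ * a₂ - a₂ * a₁) * (b₁ * b₂ - b₂ * b₁) := by
  have swap {b a : R} (h : a * b = b * a) (x y : R) : x * b * (a * y) = x * a * (b * y) :=
    Commute.mul_mul_mul_comm h.symm x y
  rw [pow_two] at ha₁ ha₂ hb₁ hb₂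
  rw [hc, pow_two]
  simp only [mul_add, add_mul, mul_sub, sub_mul, swap h11, swap h12, swap h21, swap h22,
    ha₁, ha₂, hb₁, hb₂, one_mul, mul_one]
  rw [show (4 : R) = 1 + 1 + 1 + 1 by norm_num]
  abel
end

section
/- Let A be a C*-algebra with unit and let a₁, a₂, b₁, b₂ ∈ A be self-adjoint elements with a₁² = a₂² = b₁² = b₂² = 1 and aᵢbⱼ = bⱼaᵢ for all i, j ∈ {1,2}. Let c = a₁b₁ + a₁b₂ + a₂b₁ − a₂b₂. Then ‖c‖ ≤ 2√2. -/
/-- The square of the CHSH element differs from `4` by a product of two commutators. -/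
theorem chsh_mul_self {R : Type*} [Ring R] {a₁ a₂ b₁ b₂ : R}
    (ha₁ : a₁ ^ 2 = 1) (ha₂ : a₂ ^ 2 = 1) (hb₁ : b₁ ^ 2 = 1) (hb₂ : b₂ ^ 2 = 1)
    (h11 : Commute a₁ b₁) (h12 : Commute a₁ b₂) (h21 : Commute a₂ b₁) (h22 : Commute a₂ b₂) :
    (a₁ * b₁ + a₁ * b₂ + a₂ * b₁ - a₂ * b₂) * (a₁ * b₁ + a₁ * b₂ + a₂ * b₁ - a₂ * b₂) =
      4 - (a₁ * a₂ - a₂ * a₁) * (b₁ * b₂ - b₂ * b₁) := by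
  have hc : a₁ * b₁ + a₁ * b₂ + a₂ * b₁ - a₂ * b₂ = a₁ * (b₁ + b₂) + a₂ * (b₁ - b₂) := by
    noncomm_ring
  have hb : (b₁ + b₂) * (b₁ + b₂) + (b₁ - b₂) * (b₁ - b₂) = 4 := by
    calc _ = 2 * b₁ ^ 2 + 2 * b₂ ^ 2 := by noncomm_ring
      _ = 4 := by rw [hb₁, hb₂]; norm_num
  have hm : (b₁ + b₂) * (b₁ - b₂) = -(b₁ * b₂ - b₂ * b₁) := by
    calc _ = b₁ ^ 2 - b₂ ^ 2 - (b₁ * b₂ - b₂ * b₁) := by noncomm_ring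
      _ = _ := by rw [hb₁, hb₂]; simp
  have hm' : (b₁ - b₂) * (b₁ + b₂) = b₁ * b₂ - b₂ * b₁ := by
    calc _ = b₁ ^ 2 - b₂ ^ 2 + (b₁ * b₂ - b₂ * b₁) := by noncomm_ring
      _ = _ := by rw [hb₁, hb₂]; simp
  have expand (x y : R) : (x + y) * (x + y) = x * x + x * y + y * x + y * y := by
    noncomm_ring
  rw [hc, expand, (h11.add_right h12).symm.mul_mul_mul_comm,
    (h21.add_right h22).symm.mul_mul_mul_comm, (h11.sub_right h12).symm.mul_mul_mul_comm,
    (h21.sub_right h22).symm.mul_mul_mul_comm, ← sq a₁, ← sq a₂, ha₁, ha₂, hm, hm', ← hb]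
  noncomm_ring

theorem IsSelfAdjoint.norm_eq_one_of_sq_eq_one {A : Type*} [NormedRing A] [StarRing A]
    [CStarRing A] [NormOneClass A] {a : A} (sa : IsSelfAdjoint a) (ha : a ^ 2 = 1) : ‖a‖ = 1 := by
  have h := sa.norm_mul_self
  rw [← sq, ha, norm_one] at h
  exact (pow_eq_one_iff_of_nonneg (norm_nonneg a) two_ne_zero).1 h.symm

/-- The commutator of two elements of norm one has norm at most `2`. -/
theorem norm_mul_sub_mul_le_two {A : Type*} [NormedRing A] {a b : A}
    (ha : ‖a‖ = 1) (hb : ‖b‖ = 1) : ‖a * b - b * a‖ ≤ 2 := by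
  have h₁ := norm_mul_le a b
  have h₂ := norm_mul_le b a
  rw [ha, hb] at h₁ h₂
  linarith [norm_sub_le (a * b) (b * a)]

theorem tsirelson_bound {A : Type*} [NormedRing A] [StarRing A] [CStarRing A]
    [NormedAlgebra ℂ A] [CompleteSpace A] [NormOneClass A]
    (a₁ a₂ b₁ b₂ : A)
    (sa₁ : IsSelfAdjoint a₁) (sa₂ : IsSelfAdjoint a₂)
    (sb₁ : IsSelfAdjoint b₁) (sb₂ : IsSelfAdjoint b₂)
    (ha₁ : a₁ ^ 2 = 1) (ha₂ : a₂ ^ 2 = 1) (hb₁ : b₁ ^ 2 = 1) (hb₂ : b₂ ^ 2 = 1)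
    (h11 : a₁ * b₁ = b₁ * a₁) (h12 : a₁ * b₂ = b₂ * a₁)
    (h21 : a₂ * b₁ = b₁ * a₂) (h22 : a₂ * b₂ = b₂ * a₂)
    (c : A) (hc : c = a₁ * b₁ + a₁ * b₂ + a₂ * b₁ - a₂ * b₂) :
    ‖c‖ ≤ 2 * Real.sqrt 2 := by
  have sc : IsSelfAdjoint c := by
    rw [hc]
    exact ((((sa₁.commute_iff sb₁).1 h11).add ((sa₁.commute_iff sb₂).1 h12)).add
      ((sa₂.commute_iff sb₁).1 h21)).sub ((sa₂.commute_iff sb₂).1 h22)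
  have hA := norm_mul_sub_mul_le_two (sa₁.norm_eq_one_of_sq_eq_one ha₁)
    (sa₂.norm_eq_one_of_sq_eq_one ha₂)
  have hB := norm_mul_sub_mul_le_two (sb₁.norm_eq_one_of_sq_eq_one hb₁)
    (sb₂.norm_eq_one_of_sq_eq_one hb₂)
  have h4 : ‖(4 : A)‖ ≤ 4 := by simpa using Nat.norm_cast_le (α := A) 4
  have hsq : ‖c‖ ^ 2 ≤ 8 := by
    rw [← sc.norm_mul_self, hc, chsh_mul_self ha₁ ha₂ hb₁ hb₂ h11 h12 h21 h22]
    calc _ ≤ ‖(4 : A)‖ + ‖a₁ * a₂ - a₂ * a₁‖ * ‖b₁ * b₂ - b₂ * b₁‖ :=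
          (norm_sub_le _ _).trans (by gcongr; exact norm_mul_le _ _)
      _ ≤ 4 + 2 * 2 := by gcongr
      _ = 8 := by norm_num
  refine (sq_le_sq₀ (norm_nonneg c) (by positivity)).1 ?_
  rw [mul_pow, Real.sq_sqrt zero_le_two]
  linarith
end

section
/- There exist complex 2×2 Hermitian matrices A₁, A₂, B₁, B₂ with A₁² = A₂² = B₁² = B₂² = 1 and a unit vector ψ ∈ ℂ² ⊗ ℂ² (equivalently ℂ⁴ under the Kronecker product identification) such that ⟨ψ, (A₁ ⊗ B₁ + A₁ ⊗ B₂ + A₂ ⊗ B₁ − A₂ ⊗ B₂) ψ⟩ = 2√2. -/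
open Matrix Kronecker

theorem tsirelson_attained :
    ∃ (A₁ A₂ B₁ B₂ : Matrix (Fin 2) (Fin 2) ℂ) (ψ : Fin 2 × Fin 2 → ℂ),
      A₁.IsHermitian ∧ A₂.IsHermitian ∧ B₁.IsHermitian ∧ B₂.IsHermitian ∧
      A₁ ^ 2 = 1 ∧ A₂ ^ 2 = 1 ∧ B₁ ^ 2 = 1 ∧ B₂ ^ 2 = 1 ∧
      star ψ ⬝ᵥ ψ = 1 ∧
      star ψ ⬝ᵥ ((A₁ ⊗ₖ B₁ + A₁ ⊗ₖ B₂ + A₂ ⊗ₖ B₁ - A₂ ⊗ₖ B₂) *ᵥ ψ)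
        = ((2 * Real.sqrt 2 : ℝ) : ℂ) := by
  -- `A₁ = σ_z`, `A₂ = σ_x`, `Bᵢ = (σ_z ± σ_x) / √2`, and `ψ = (|00⟩ + |11⟩) / √2`
  obtain ⟨s, hs, hsq, hval⟩ : ∃ s : ℂ, (starRingEnd ℂ) s = s ∧ s ^ 2 = 1 / 2 ∧
      ((2 * Real.sqrt 2 : ℝ) : ℂ) = 4 * s := by
    refine ⟨((Real.sqrt 2 / 2 : ℝ) : ℂ), Complex.conj_ofReal _, ?_, ?_⟩
    · rw [← Complex.ofReal_pow, div_pow, Real.sq_sqrt zero_le_two]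
      norm_num
    · push_cast
      ring
  refine ⟨!![1, 0; 0, -1], !![0, 1; 1, 0], !![s, s; s, -s], !![s, -s; -s, -s],
    fun p => if p.1 = p.2 then s else 0, ?_, ?_, ?_, ?_, ?_, ?_, ?_, ?_, ?_, ?_⟩
  iterate 4
    · ext i j
      fin_cases i <;> fin_cases j <;> simp [hs]
  iterate 4
    · ext i j
      fin_cases i <;> fin_cases j <;> simp [sq, Matrix.mul_apply, Fin.sum_univ_two] <;>
        linear_combination 2 * hsq
  · simp [dotProduct, Fintype.sum_prod_type, hs]
    linear_combination 2 * hsq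
  · rw [hval]
    simp [dotProduct, mulVec, Fintype.sum_prod_type, Fin.sum_univ_two, hs, kroneckerMap_apply]
    linear_combination 8 * s * hsq
end

section
/- For 1/3 < p ≤ 1, the two-qubit Werner state ρ_W(p) = p |ψ⁻⟩⟨ψ⁻| + ((1−p)/4) I₄, where ψ⁻ = (e₀ ⊗ e₁ − e₁ ⊗ e₀)/√2 ∈ ℂ² ⊗ ℂ² is the singlet state and I₄ is the 4×4 identity matrix, is not separable: it cannot be written as a finite convex combination ∑ᵢ pᵢ σᵢ ⊗ τᵢ of Kronecker products of density matrices σᵢ, τᵢ on ℂ². -/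
open Matrix Kronecker
open scoped ComplexOrder

def IsDensityMatrix {n : Type*} [Fintype n] (ρ : Matrix n n ℂ) : Prop :=
  ρ.PosSemidef ∧ ρ.trace = 1

def SeparableState {m n : Type*} [Fintype m] [Fintype n]
    (ρ : Matrix (m × n) (m × n) ℂ) : Prop :=
  ∃ (k : ℕ) (p : Fin k → ℝ) (σ : Fin k → Matrix m m ℂ) (τ : Fin k → Matrix n n ℂ),
    (∀ i, 0 ≤ p i) ∧ (∑ i, p i = 1) ∧
    (∀ i, IsDensityMatrix (σ i)) ∧ (∀ i, IsDensityMatrix (τ i)) ∧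
    ρ = ∑ i, ((p i : ℂ) • (σ i ⊗ₖ τ i))

noncomputable def singlet : Fin 2 × Fin 2 → ℂ := fun ki =>
  if ki = (0, 1) then ((Real.sqrt 2)⁻¹ : ℝ)
  else if ki = (1, 0) then -((Real.sqrt 2)⁻¹ : ℝ)
  else 0

noncomputable def wernerState (p : ℝ) : Matrix (Fin 2 × Fin 2) (Fin 2 × Fin 2) ℂ :=
  (p : ℂ) • Matrix.of (fun i j => singlet i * star (singlet j))
    + (((1 - p) / 4 : ℝ) : ℂ) • (1 : Matrix (Fin 2 × Fin 2) (Fin 2 × Fin 2) ℂ)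

open scoped MatrixOrder in
/-- The trace of a product of two positive semidefinite matrices is nonnegative. -/
theorem trace_mul_nonneg_of_posSemidef {n : Type*} [Fintype n] {A B : Matrix n n ℂ}
    (hA : A.PosSemidef) (hB : B.PosSemidef) : 0 ≤ (A * B).trace := by
  classical
  obtain ⟨C, rfl⟩ := CStarAlgebra.nonneg_iff_eq_star_mul_self.mp hB.nonneg
  rw [← Matrix.mul_assoc, Matrix.trace_mul_comm, ← Matrix.mul_assoc]
  exact (hA.mul_mul_conjTranspose_same C).trace_nonneg

/-- The swap operator is an entanglement witness: its expectation in a separable state is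
nonnegative. -/
theorem SeparableState.swap_expectation_nonneg {n : Type*} [Fintype n]
    {ρ : Matrix (n × n) (n × n) ℂ} (h : SeparableState ρ) :
    0 ≤ ∑ i, ∑ j, ρ (i, j) (j, i) := by
  obtain ⟨k, p, σ, τ, hp, -, hσ, hτ, rfl⟩ := h
  have key : ∑ i, ∑ j, (∑ l, (p l : ℂ) • (σ l ⊗ₖ τ l)) (i, j) (j, i)
      = ∑ l, (p l : ℂ) * (σ l * τ l).trace := by
    simp only [Matrix.sum_apply, Matrix.smul_apply, Matrix.kroneckerMap_apply, smul_eq_mul,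
      Matrix.trace, Matrix.diag_apply, Matrix.mul_apply, Finset.mul_sum]
    rw [Finset.sum_comm]
    simp_rw [Finset.sum_comm (s := Finset.univ (α := n)) (t := Finset.univ (α := Fin k))]
    refine Finset.sum_congr rfl fun l _ => ?_
    exact Finset.sum_comm
  rw [key]
  exact Finset.sum_nonneg fun l _ => mul_nonneg (Complex.zero_le_real.mpr (hp l))
    (trace_mul_nonneg_of_posSemidef (hσ l).1 (hτ l).1)

theorem wernerState_swap_expectation (p : ℝ) :
    ∑ i, ∑ j, wernerState p (i, j) (j, i) = ((1 - 3 * p) / 2 : ℝ) := by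
  have h : ((Real.sqrt 2 : ℝ) : ℂ)⁻¹ * ((Real.sqrt 2 : ℝ) : ℂ)⁻¹ = 1 / 2 := by
    rw [← mul_inv, ← Complex.ofReal_mul, Real.mul_self_sqrt (by norm_num)]
    norm_num
  simp [Fin.sum_univ_two, wernerState, singlet, h]
  ring

theorem werner_entangled (p : ℝ) (hp : 1 / 3 < p) (hp1 : p ≤ 1) :
    ¬ SeparableState (wernerState p) := by
  intro h
  have hnonneg := h.swap_expectation_nonneg
  rw [wernerState_swap_expectation, Complex.zero_le_real] at hnonneg
  linarith
end

section
/- Let m, n be finite nonempty index types, let ρ_in be a density matrix on ℂᵐ, and let U be a unitary matrix on the Kronecker product space indexed by m × n. Then there exists a density matrix ρ on ℂⁿ satisfying Deutsch's causal consistency condition ρ = Tr_ch[U (ρ_in ⊗ ρ) U†], i.e. for all i, j: ρ i j = ∑ₖ (U (ρ_in ⊗ ρ) U†) ((k, i), (k, j)). -/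
open Matrix Kronecker
open scoped ComplexOrder

/-- Partial trace over the first tensor factor. -/
noncomputable def ptraceFst {m n : Type*} [Fintype m]
    (M : Matrix (m × n) (m × n) ℂ) : Matrix n n ℂ :=
  Matrix.of fun i j => ∑ k : m, M (k, i) (k, j)

open Filter Topology Function in
/-- A continuous linear map that preserves a nonempty compact convex set has a fixed point in it. -/
theorem ContinuousLinearMap.exists_isFixedPt_of_isCompact_convex {E : Type*}
    [NormedAddCommGroup E] [NormedSpace ℝ E] (T : E →L[ℝ] E) {s : Set E} (hne : s.Nonempty)
    (hc : IsCompact s) (hconv : Convex ℝ s) (hT : Set.MapsTo T s s) :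
    ∃ x ∈ s, IsFixedPt T x := by
  obtain ⟨x, hx⟩ := hne
  have hiter (k : ℕ) : T^[k] x ∈ s := hT.iterate k hx
  have hlim : Tendsto (fun N : ℕ ↦ T (birkhoffAverage ℝ T id N x) - birkhoffAverage ℝ T id N x)
      atTop (𝓝 0) := by
    have hbdd : Bornology.IsBounded (Set.range fun k : ℕ ↦ id (T^[k] x)) :=
      hc.isBounded.subset (Set.range_subset_iff.2 hiter)
    refine (tendsto_birkhoffAverage_apply_sub_birkhoffAverage ℝ hbdd).congr fun N ↦ ?_
    simp only [birkhoffAverage, birkhoffSum, id, map_smul, map_sum, ← iterate_succ_apply,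
      ← iterate_succ_apply']
  have hmem (N : ℕ) : birkhoffAverage ℝ T id (N + 1) x ∈ s := by
    rw [birkhoffAverage, birkhoffSum, Finset.smul_sum]
    refine hconv.sum_mem (fun _ _ ↦ by positivity) ?_ fun k _ ↦ hiter k
    simp [Nat.cast_add_one_ne_zero]
  obtain ⟨a, ha, φ, hφ, hφa⟩ := hc.tendsto_subseq hmem
  refine ⟨a, ha, sub_eq_zero.1 <| tendsto_nhds_unique
    (((T.continuous.tendsto a).comp hφa).sub hφa) ?_⟩
  exact hlim.comp ((tendsto_add_atTop_nat 1).comp hφ.tendsto_atTop)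

namespace IsDensityMatrix

variable {m n : Type*} [Fintype m] [Fintype n]

theorem exists_isDensityMatrix [Nonempty n] [DecidableEq n] :
    ∃ ρ : Matrix n n ℂ, IsDensityMatrix ρ := by
  obtain ⟨i⟩ := ‹Nonempty n›
  refine ⟨diagonal (Pi.single i 1), PosSemidef.diagonal (Pi.single_nonneg.2 zero_le_one), ?_⟩
  simp [trace_diagonal]

theorem convex_setOf : Convex ℝ {ρ : Matrix n n ℂ | IsDensityMatrix ρ} := by
  rintro ρ hρ σ hσ a b ha hb hab
  refine ⟨(hρ.1.smul ha).add (hσ.1.smul hb), ?_⟩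
  rw [trace_add, trace_smul, trace_smul, hρ.2, hσ.2, ← add_smul, hab, one_smul]

attribute [local instance] Matrix.frobeniusNormedAddCommGroup Matrix.frobeniusNormedSpace

theorem trace_conjTranspose_mul_self_eq_norm_sq (B : Matrix m n ℂ) :
    (Bᴴ * B).trace = ((‖B‖ ^ 2 : ℝ) : ℂ) := by
  rw [frobenius_norm_def, ← Real.sqrt_eq_rpow, Real.sq_sqrt (by positivity), Finset.sum_comm]
  simp [trace, mul_apply, Complex.conj_mul']

open MatrixOrder in
theorem setOf_eq_image_sphere [DecidableEq n] :
    {ρ : Matrix n n ℂ | IsDensityMatrix ρ} =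
      (fun B : Matrix n n ℂ ↦ Bᴴ * B) '' Metric.sphere 0 1 := by
  have hsphere (B : Matrix n n ℂ) : (Bᴴ * B).trace = 1 ↔ B ∈ Metric.sphere 0 1 := by
    rw [trace_conjTranspose_mul_self_eq_norm_sq, mem_sphere_zero_iff_norm, Complex.ofReal_eq_one,
      pow_eq_one_iff_of_nonneg (norm_nonneg B) two_ne_zero]
  ext ρ
  constructor
  · rintro ⟨hpos, htr⟩
    obtain ⟨B, rfl⟩ := CStarAlgebra.nonneg_iff_eq_star_mul_self.1 hpos.nonneg
    exact ⟨B, (hsphere B).1 htr, rfl⟩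
  · rintro ⟨B, hB, rfl⟩
    exact ⟨posSemidef_conjTranspose_mul_self B, (hsphere B).2 hB⟩

theorem isCompact_setOf [DecidableEq n] : IsCompact {ρ : Matrix n n ℂ | IsDensityMatrix ρ} := by
  have : ProperSpace (Matrix n n ℂ) := FiniteDimensional.proper ℂ _
  rw [setOf_eq_image_sphere]
  exact (isCompact_sphere _ _).image (by fun_prop)

theorem kronecker [DecidableEq m] [DecidableEq n] {ρ : Matrix m m ℂ} {σ : Matrix n n ℂ}
    (hρ : IsDensityMatrix ρ) (hσ : IsDensityMatrix σ) : IsDensityMatrix (ρ ⊗ₖ σ) :=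
  ⟨hρ.1.kronecker hσ.1, by rw [trace_kronecker, hρ.2, hσ.2, one_mul]⟩

theorem unitary_conj [DecidableEq n] {ρ : Matrix n n ℂ} (hρ : IsDensityMatrix ρ)
    {U : Matrix n n ℂ} (hU : U ∈ unitaryGroup n ℂ) : IsDensityMatrix (U * ρ * Uᴴ) := by
  refine ⟨hρ.1.mul_mul_conjTranspose_same U, ?_⟩
  rw [trace_mul_cycle, ← star_eq_conjTranspose, mem_unitaryGroup_iff'.1 hU, one_mul, hρ.2]

theorem ptraceFst {M : Matrix (m × n) (m × n) ℂ} (hM : IsDensityMatrix M) :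
    IsDensityMatrix (ptraceFst M) := by
  constructor
  · have : _root_.ptraceFst M = ∑ k : m, M.submatrix (Prod.mk k) (Prod.mk k) := by
      ext i j
      simp [_root_.ptraceFst, Matrix.sum_apply]
    rw [this]
    exact posSemidef_sum _ fun k _ ↦ hM.1.submatrix _
  · rw [← hM.2]
    simp [_root_.ptraceFst, trace, Fintype.sum_prod_type_right]

end IsDensityMatrix

section

variable {m n : Type*} [Fintype m] [Fintype n]

/-- The evolution `ρ ↦ Tr_ch[U (ρin ⊗ ρ) U†]` of the CTC state, as a real linear map. -/
noncomputable def ctcEvolution (ρin : Matrix m m ℂ) (U : Matrix (m × n) (m × n) ℂ) :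
    Matrix n n ℂ →ₗ[ℝ] Matrix n n ℂ where
  toFun ρ := ptraceFst (U * (ρin ⊗ₖ ρ) * Uᴴ)
  map_add' ρ σ := by
    ext i j
    simp [ptraceFst, kronecker_add, mul_add, add_mul, Finset.sum_add_distrib]
  map_smul' c ρ := by
    ext i j
    simp [ptraceFst, kronecker_smul, Finset.mul_sum]

attribute [local instance] Matrix.frobeniusNormedAddCommGroup Matrix.frobeniusNormedSpace

theorem exists_isDensityMatrix_isFixedPt_ctcEvolution [Nonempty n] [DecidableEq m] [DecidableEq n]
    {ρin : Matrix m m ℂ} (hρin : IsDensityMatrix ρin)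
    {U : Matrix (m × n) (m × n) ℂ} (hU : U ∈ unitaryGroup (m × n) ℂ) :
    ∃ ρ, IsDensityMatrix ρ ∧ Function.IsFixedPt (ctcEvolution ρin U) ρ :=
  (LinearMap.toContinuousLinearMap (ctcEvolution ρin U)).exists_isFixedPt_of_isCompact_convex
    IsDensityMatrix.exists_isDensityMatrix IsDensityMatrix.isCompact_setOf
    IsDensityMatrix.convex_setOf fun _ hρ ↦ ((hρin.kronecker hρ).unitary_conj hU).ptraceFst

end

theorem deutsch_consistency_exists {m n : Type*} [Fintype m] [Fintype n]
    [Nonempty m] [Nonempty n] [DecidableEq m] [DecidableEq n]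
    (ρin : Matrix m m ℂ) (hρin : IsDensityMatrix ρin)
    (U : Matrix (m × n) (m × n) ℂ) (hU : U ∈ Matrix.unitaryGroup (m × n) ℂ) :
    ∃ ρ : Matrix n n ℂ, IsDensityMatrix ρ ∧
      ρ = ptraceFst (U * (ρin ⊗ₖ ρ) * Uᴴ) := by
  obtain ⟨ρ, hρ, hfix⟩ := exists_isDensityMatrix_isFixedPt_ctcEvolution hρin hU
  exact ⟨ρ, hρ, hfix.symm⟩
end
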